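/- Main theorem for connected boundary: let N − 1 < p and let Ω ⊂ ℝ^N be a bounded domain whose boundary ∂Ω is connected. Then there exists a positive constant C(N,p) such that λ_{1,p}(Ω) ≥ C(N,p) ρ_Ω^{-p}. -/

import Mathlib

open MeasureTheory Metric Set

noncomputable def pEigen (N : ℕ) (p : ℝ) (Ω : Set (EuclideanSpace ℝ (Fin N))) : ℝ :=
  sInf { t | ∃ u : EuclideanSpace ℝ (Fin N) → ℝ, ContDiff ℝ (⊤ : ℕ∞) u ∧ HasCompactSupport u ∧
      tsupport u ⊆ Ω ∧ u ≠ 0 ∧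
      t = (∫ x in Ω, ‖fderiv ℝ u x‖ ^ p) / (∫ x in Ω, |u x| ^ p) }

noncomputable def inradius (N : ℕ) (Ω : Set (EuclideanSpace ℝ (Fin N))) : ℝ :=
  sSup { r | ∃ c : EuclideanSpace ℝ (Fin N), Metric.ball c r ⊆ Ω }

open scoped ENNReal

lemma scale_bound (d : ℕ) (h : (Fin d → ℝ) → ℝ≥0∞) (hh : Measurable h) (a : Fin d → ℝ)
    (ha : a ∈ closedBall (0 : Fin d → ℝ) 1) (s : ℝ) (hs : s ∈ Ioo (0:ℝ) 1) :
    ∫⁻ w in closedBall (0 : Fin d → ℝ) 1, h (a + s • (w - a)) ≤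
      ENNReal.ofReal (s ^ (-(d:ℝ))) * ∫⁻ w in closedBall (0 : Fin d → ℝ) 1, h w := by
  set Q := closedBall (0 : Fin d → ℝ) 1 with hQ
  have hQm : MeasurableSet Q := isClosed_closedBall.measurableSet
  have hk : Measurable (Q.indicator h) := hh.indicator hQm
  have conv : ∀ w ∈ Q, a + s • (w - a) ∈ Q := by
    intro w hw
    exact (convex_closedBall (0 : Fin d → ℝ) 1).add_smul_sub_mem ha hw ⟨hs.1.le, hs.2.le⟩
  calc ∫⁻ w in Q, h (a + s • (w - a)) 
      = ∫⁻ w in Q, Q.indicator h (s • w + (a - s • a)) := by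
        apply setLIntegral_congr_fun hQm
        intro w hw
        have : a + s • (w - a) = s • w + (a - s • a) := by rw [smul_sub]; abel
        simp only
        rw [← this, indicator_of_mem (conv w hw)]
    _ ≤ ∫⁻ w, Q.indicator h (s • w + (a - s • a)) := setLIntegral_le_lintegral _ _
    _ = ∫⁻ w, Q.indicator h (w + (a - s • a)) ∂(Measure.map (s • ·) volume) := by
        exact (lintegral_map (f := fun w => Q.indicator h (w + (a - s • a)))
          (hk.comp (measurable_id.add_const _)) (measurable_const_smul s)).symm
    _ = ENNReal.ofReal (s ^ (-(d:ℝ))) * ∫⁻ w, Q.indicator h (w + (a - s • a)) := by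
        rw [Measure.map_addHaar_smul _ hs.1.ne', lintegral_smul_measure]
        congr 2
        rw [Real.rpow_neg hs.1.le, Real.rpow_natCast, abs_of_pos (by have := hs.1; positivity)]
        simp
    _ = ENNReal.ofReal (s ^ (-(d:ℝ))) * ∫⁻ w, Q.indicator h w := by
        rw [lintegral_add_right_eq_self]
    _ = _ := by rw [lintegral_indicator hQm]

lemma ftc_bound (d : ℕ) (f : (Fin d → ℝ) → ℝ) (hf : ContDiff ℝ 1 f) (a w : Fin d → ℝ)
    (ha : a ∈ closedBall (0 : Fin d → ℝ) 1) (hw : w ∈ closedBall (0 : Fin d → ℝ) 1) :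
    ‖f w - f a‖ₑ ≤ ∫⁻ s in Ioo (0:ℝ) 1, 2 * ‖fderiv ℝ f (a + s • (w - a))‖ₑ := by
  have hc : Continuous (fderiv ℝ f) := hf.continuous_fderiv (by norm_num)
  have hd : ∀ s : ℝ, HasDerivAt (fun s : ℝ => f (a + s • (w - a)))
      (fderiv ℝ f (a + s • (w - a)) (w - a)) s := by
    intro s
    have h1 : HasDerivAt (fun s : ℝ => a + s • (w - a)) (w - a) s := by
      simpa using ((hasDerivAt_id s).smul_const (w - a)).const_add a
    exact ((hf.differentiable (by norm_num)) _).hasFDerivAt.comp_hasDerivAt s h1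
  have hc2 : Continuous (fun s : ℝ => fderiv ℝ f (a + s • (w - a)) (w - a)) :=
    (hc.comp (by fun_prop)).clm_apply continuous_const
  have h2 := intervalIntegral.integral_eq_sub_of_hasDerivAt (a := 0) (b := 1)
    (fun s _ => hd s) (hc2.intervalIntegrable _ _)
  simp only [one_smul, zero_smul, add_zero, add_sub_cancel] at h2
  rw [← h2, intervalIntegral.integral_of_le zero_le_one, integral_Ioc_eq_integral_Ioo]
  refine (enorm_integral_le_lintegral_enorm _).trans (lintegral_mono fun s => ?_)
  have hn : ‖w - a‖ₑ ≤ 2 := by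
    have : ‖w - a‖ ≤ 2 := by
      have := norm_sub_le w a
      simp at ha hw
      linarith
    rw [← ofReal_norm]
    exact ENNReal.ofReal_le_of_le_toReal (by simpa using this)
  calc _ ≤ ‖fderiv ℝ f (a + s • (w - a))‖ₑ * ‖w - a‖ₑ := ContinuousLinearMap.le_opENorm _ _
    _ ≤ _ := by rw [mul_comm]; gcongr

lemma morrey_avg (d : ℕ) (p : ℝ) (hp : (d:ℝ) < p) (hp1 : 1 < p) :
    ∃ K : ℝ≥0∞, K ≠ ⊤ ∧ ∀ f : (Fin d → ℝ) → ℝ, ContDiff ℝ 1 f →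
      ∀ a ∈ closedBall (0 : Fin d → ℝ) 1, 
      ∫⁻ w in closedBall (0 : Fin d → ℝ) 1, ‖f w - f a‖ₑ ≤
        K * (∫⁻ r in closedBall (0 : Fin d → ℝ) 1, ‖fderiv ℝ f r‖ₑ ^ p) ^ (1/p) := by
  have hp0 : 0 < p := by linarith
  set Q := closedBall (0 : Fin d → ℝ) 1 with hQ
  have hQm : MeasurableSet Q := isClosed_closedBall.measurableSet
  have hQt : volume Q ≠ ⊤ := (isCompact_closedBall _ _).measure_lt_top.ne
  set J := ∫⁻ s in Ioo (0:ℝ) 1, ENNReal.ofReal (s ^ (-(d:ℝ)/p)) with hJ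
  have hJt : J ≠ ⊤ := by
    have h1 : IntegrableOn (fun s : ℝ => s ^ (-(d:ℝ)/p)) (Ioo 0 1) :=
      (intervalIntegral.integrableOn_Ioo_rpow_iff zero_lt_one).2 (by
        rw [lt_div_iff₀ hp0]; linarith)
    exact h1.lintegral_lt_top.ne
  set q := p / (p - 1) with hq
  have hpq : p.HolderConjugate q := Real.HolderConjugate.conjExponent hp1
  refine ⟨2 * (volume Q) ^ (1/q) * J, ?_, ?_⟩
  · refine ENNReal.mul_ne_top (ENNReal.mul_ne_top (by simp) ?_) hJt
    exact ENNReal.rpow_ne_top_of_nonneg (by have := hpq.symm.pos; positivity) hQt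
  intro f hf a ha
  have hc : Continuous (fderiv ℝ f) := hf.continuous_fderiv (by norm_num)
  set I := ∫⁻ r in Q, ‖fderiv ℝ f r‖ₑ ^ p with hI
  have step : ∀ s ∈ Ioo (0:ℝ) 1, ∫⁻ w in Q, 2 * ‖fderiv ℝ f (a + s • (w - a))‖ₑ ≤
      (2 * (volume Q) ^ (1/q) * I ^ (1/p)) * ENNReal.ofReal (s ^ (-(d:ℝ)/p)) := by
    intro s hs
    have hm : Measurable (fun w => ‖fderiv ℝ f (a + s • (w - a))‖ₑ) :=
      (hc.comp (by fun_prop : Continuous fun w : Fin d → ℝ => a + s • (w - a))).enorm.measurable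
    rw [lintegral_const_mul _ hm]
    have h1 := ENNReal.lintegral_mul_le_Lp_mul_Lq (volume.restrict Q) hpq hm.aemeasurable
      (g := fun _ => 1) aemeasurable_const
    simp only [Pi.mul_apply, mul_one, ENNReal.one_rpow, lintegral_const, one_mul,
      Measure.restrict_apply_univ] at h1
    have h2 := scale_bound d (fun r => ‖fderiv ℝ f r‖ₑ ^ p) (hc.enorm.measurable.pow_const p) a ha s hs
    have h3 : (∫⁻ w in Q, ‖fderiv ℝ f (a + s • (w - a))‖ₑ ^ p) ^ (1/p) ≤
        ENNReal.ofReal (s ^ (-(d:ℝ)/p)) * I ^ (1/p) := by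
      calc _ ≤ (ENNReal.ofReal (s ^ (-(d:ℝ))) * I) ^ (1/p) := by gcongr
        _ = _ := by
          rw [ENNReal.mul_rpow_of_nonneg _ _ (by positivity),
            ENNReal.ofReal_rpow_of_nonneg (Real.rpow_nonneg hs.1.le _) (by positivity),
            ← Real.rpow_mul hs.1.le]
          congr 3; ring_nf
    calc _ ≤ 2 * ((ENNReal.ofReal (s ^ (-(d:ℝ)/p)) * I ^ (1/p)) * (volume Q) ^ (1/q)) := by
          gcongr; exact h1.trans (by gcongr)
      _ = _ := by ring
  calc ∫⁻ w in Q, ‖f w - f a‖ₑ 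
      ≤ ∫⁻ w in Q, ∫⁻ s in Ioo (0:ℝ) 1, 2 * ‖fderiv ℝ f (a + s • (w - a))‖ₑ :=
        setLIntegral_mono' hQm fun w hw => ftc_bound d f hf a w ha hw
    _ = ∫⁻ s in Ioo (0:ℝ) 1, ∫⁻ w in Q, 2 * ‖fderiv ℝ f (a + s • (w - a))‖ₑ := by
        apply lintegral_lintegral_swap
        apply Measurable.aemeasurable
        apply Measurable.const_mul
        exact (hc.comp (by fun_prop : Continuous fun z : (Fin d → ℝ) × ℝ => 
          a + z.2 • (z.1 - a))).enorm.measurable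
    _ ≤ ∫⁻ s in Ioo (0:ℝ) 1, (2 * (volume Q) ^ (1/q) * I ^ (1/p)) * ENNReal.ofReal (s ^ (-(d:ℝ)/p)) :=
        setLIntegral_mono' measurableSet_Ioo step
    _ = (2 * (volume Q) ^ (1/q) * I ^ (1/p)) * J := by
        rw [lintegral_const_mul]
        exact (measurable_id.pow_const _).ennreal_ofReal
    _ = _ := by ring

lemma morrey (d : ℕ) (p : ℝ) (hp : (d:ℝ) < p) (hp1 : 1 < p) :
    ∃ K : ℝ≥0∞, K ≠ ⊤ ∧ ∀ f : (Fin d → ℝ) → ℝ, ContDiff ℝ 1 f →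
      ∀ a ∈ closedBall (0 : Fin d → ℝ) 1, ∀ b ∈ closedBall (0 : Fin d → ℝ) 1, 
      ‖f a - f b‖ₑ ≤
        K * (∫⁻ r in closedBall (0 : Fin d → ℝ) 1, ‖fderiv ℝ f r‖ₑ ^ p) ^ (1/p) := by
  obtain ⟨K, hK, h⟩ := morrey_avg d p hp hp1
  set Q := closedBall (0 : Fin d → ℝ) 1 with hQ
  have hQm : MeasurableSet Q := isClosed_closedBall.measurableSet
  have hQt : volume Q ≠ ⊤ := (isCompact_closedBall _ _).measure_lt_top.ne
  have hQ0 : volume Q ≠ 0 := (measure_closedBall_pos _ _ one_pos).ne'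
  refine ⟨2 * K / volume Q, ENNReal.div_ne_top (ENNReal.mul_ne_top (by simp) hK) hQ0, ?_⟩
  intro f hf a ha b hb
  set I := (∫⁻ r in Q, ‖fderiv ℝ f r‖ₑ ^ p) ^ (1/p)
  have h1 : ‖f a - f b‖ₑ * volume Q ≤ 2 * K * I := by
    calc ‖f a - f b‖ₑ * volume Q = ∫⁻ w in Q, ‖f a - f b‖ₑ := by simp
      _ ≤ ∫⁻ w in Q, (‖f w - f a‖ₑ + ‖f w - f b‖ₑ) := by
        refine lintegral_mono fun w => ?_
        have : f a - f b = (f w - f b) - (f w - f a) := by ring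
        rw [this, add_comm]
        exact enorm_sub_le
      _ = (∫⁻ w in Q, ‖f w - f a‖ₑ) + ∫⁻ w in Q, ‖f w - f b‖ₑ := by
        apply lintegral_add_left
        exact (hf.continuous.sub continuous_const).enorm.measurable
      _ ≤ K * I + K * I := by gcongr <;> apply h f hf <;> assumption
      _ = _ := by ring
  have h2 : ‖f a - f b‖ₑ ≤ 2 * K * I / volume Q := (ENNReal.le_div_iff_mul_le (Or.inl hQ0) (Or.inl hQt)).2 h1
  refine h2.trans_eq ?_
  simp only [div_eq_mul_inv]; ring

lemma hit_frontier {X : Type*} [TopologicalSpace X] {S Om : Set X} (hS : IsPreconnected S)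
    (hO : IsOpen Om) {a b : X} (ha : a ∈ S) (haO : a ∈ Om) (hb : b ∈ S) (hbO : b ∉ Om) :
    ∃ x ∈ S, x ∈ frontier Om := by
  by_contra hcon
  push Not at hcon
  have hmem : ∀ x ∈ S, x ∈ Om ∨ x ∈ (closure Om)ᶜ := by
    intro x hx
    by_contra h
    push Not at h
    refine hcon x hx ?_
    rw [hO.frontier_eq]
    exact ⟨not_not.1 h.2, h.1⟩
  obtain ⟨x, -, hx1, hx2⟩ := hS Om (closure Om)ᶜ hO isClosed_closure.isOpen_compl
    (fun x hx => hmem x hx) ⟨a, ha, haO⟩ ⟨b, hb, (hmem b hb).resolve_left hbO⟩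
  exact hx2 (subset_closure hx1)

/-- the constant vector of ones -/
noncomputable def onesVec (N : ℕ) : EuclideanSpace ℝ (Fin N) := WithLp.toLp 2 (fun _ => 1)

lemma norm_ones (d : ℕ) : ‖(onesVec (d+1)).ofLp‖ = 1 := by
  have : (onesVec (d+1)).ofLp = fun _ => (1:ℝ) := rfl
  rw [this, pi_norm_const]; simp

lemma meets_sphere (d : ℕ) (Om : Set (EuclideanSpace ℝ (Fin (d+1)))) (hO : IsOpen Om)
    (hB : Bornology.IsBounded Om) (hF : IsConnected (frontier Om))
    (c e : EuclideanSpace ℝ (Fin (d+1))) (t : ℝ) (ht : 0 < t) (he : e ∉ Om)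
    (het : ‖(e - c).ofLp‖ ≤ t) : ∃ z, z ∉ Om ∧ ‖(z - c).ofLp‖ = t := by
  by_contra hcon
  push Not at hcon
  have hS : ∀ z, ‖(z - c).ofLp‖ = t → z ∈ Om := fun z hz => by
    by_contra h; exact hcon z h hz
  have hnk : ∀ k : ℝ, 0 ≤ k → ‖((c + k • onesVec (d+1)) - c).ofLp‖ = k := by
    intro k hk
    rw [add_sub_cancel_left, WithLp.ofLp_smul, norm_smul, norm_ones, mul_one, Real.norm_of_nonneg hk]
  have hs0 : c + t • onesVec (d+1) ∈ Om := hS _ (hnk t ht.le)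
  have hcont : Continuous (fun x : EuclideanSpace ℝ (Fin (d+1)) => ‖(x - c).ofLp‖) := by fun_prop
  -- inner frontier point
  obtain ⟨x1, hx1, hx1F⟩ := hit_frontier (convex_segment e (c + t • onesVec (d+1))).isPreconnected hO
    (right_mem_segment ℝ _ _) hs0 (left_mem_segment ℝ _ _) he
  have hm1 : ‖(x1 - c).ofLp‖ ≤ t := by
    obtain ⟨α, β, hα, hβ, hab, rfl⟩ := hx1
    have h1 : α • e + β • (c + t • onesVec (d+1)) - c
        = α • (e - c) + β • ((c + t • onesVec (d+1)) - c) := by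
      have : c = α • c + β • c := by rw [← add_smul, hab, one_smul]
      nth_rewrite 2 [this]
      simp only [smul_sub, smul_add]; abel
    rw [h1, WithLp.ofLp_add, WithLp.ofLp_smul, WithLp.ofLp_smul]
    refine (norm_add_le _ _).trans ?_
    rw [norm_smul, norm_smul, hnk t ht.le, Real.norm_of_nonneg hα, Real.norm_of_nonneg hβ]
    nlinarith
  -- outer frontier point
  obtain ⟨R, hR⟩ := Bornology.IsBounded.subset_closedBall hB c
  set k := max R t + 1 with hk
  have hkt : t ≤ k := by have := le_max_right R t; linarith
  have hkR : R < k := by have := le_max_left R t; linarith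
  have hfar : c + k • onesVec (d+1) ∉ Om := by
    intro h
    have h1 := hR h
    rw [mem_closedBall, dist_eq_norm, add_sub_cancel_left] at h1
    have h2 := PiLp.norm_apply_le (k • onesVec (d+1)) (0 : Fin (d+1))
    have h3 : (k • onesVec (d+1)) 0 = k := by simp [onesVec]
    rw [h3, Real.norm_of_nonneg (by linarith)] at h2
    linarith
  obtain ⟨x2, hx2, hx2F⟩ := hit_frontier
    (convex_segment (c + k • onesVec (d+1)) (c + t • onesVec (d+1))).isPreconnected hO
    (right_mem_segment ℝ _ _) hs0 (left_mem_segment ℝ _ _) hfar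
  have hm2 : t ≤ ‖(x2 - c).ofLp‖ := by
    obtain ⟨α, β, hα, hβ, hab, rfl⟩ := hx2
    have h1 : α • (c + k • onesVec (d+1)) + β • (c + t • onesVec (d+1))
        = c + (α * k + β * t) • onesVec (d+1) := by
      have : c = α • c + β • c := by rw [← add_smul, hab, one_smul]
      nth_rewrite 3 [this]
      simp only [smul_add, add_smul, mul_smul]; abel
    rw [h1, hnk _ (by nlinarith)]
    nlinarith
  obtain ⟨z, hzF, hz⟩ := hF.isPreconnected.intermediate_value hx1F hx2F hcont.continuousOn
    (show t ∈ Icc _ _ from ⟨hm1, hm2⟩)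
  rw [hO.frontier_eq] at hzF
  exact hzF.2 (hS z hz)

/-- the coordinate inclusion of a face -/
noncomputable def faceL (d : ℕ) (i : Fin (d+1)) : (Fin d → ℝ) →L[ℝ] EuclideanSpace ℝ (Fin (d+1)) :=
  ((PiLp.continuousLinearEquiv 2 ℝ (fun _ : Fin (d+1) => ℝ)).symm :
    (Fin (d+1) → ℝ) →L[ℝ] EuclideanSpace ℝ (Fin (d+1))).comp
  (ContinuousLinearMap.pi (Fin.insertNth (α := fun _ => (Fin d → ℝ) →L[ℝ] ℝ) i 0
    (fun j => ContinuousLinearMap.proj j)))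

lemma faceL_same (d : ℕ) (i : Fin (d+1)) (r : Fin d → ℝ) : faceL d i r i = 0 := by
  simp [faceL]

lemma faceL_above (d : ℕ) (i : Fin (d+1)) (r : Fin d → ℝ) (j : Fin d) :
    faceL d i r (i.succAbove j) = r j := by
  simp [faceL]

/-- points of the face -/
noncomputable def facePt (d : ℕ) (i : Fin (d+1)) (σ t : ℝ) (r : Fin d → ℝ) : 
    EuclideanSpace ℝ (Fin (d+1)) :=
  t • (EuclideanSpace.single i σ + faceL d i r)

lemma exists_face (d : ℕ) (i : Fin (d+1)) (σ t : ℝ) (ht : 0 < t) (y : EuclideanSpace ℝ (Fin (d+1)))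
    (hi : y i = σ * t) (hy : ∀ j, |y j| ≤ t) :
    ∃ r ∈ closedBall (0 : Fin d → ℝ) 1, y = facePt d i σ t r := by
  refine ⟨fun j => y (i.succAbove j) / t, ?_, ?_⟩
  · rw [mem_closedBall_zero_iff, pi_norm_le_iff_of_nonneg zero_le_one]
    intro j
    rw [norm_div, Real.norm_of_nonneg ht.le, div_le_one ht]
    exact hy _
  · ext j
    rcases Fin.eq_self_or_eq_succAbove i j with rfl | ⟨k, rfl⟩
    · simp [facePt, faceL_same, hi, mul_comm]
    · simp [facePt, faceL_above]
      field_simp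

lemma face_osc (d : ℕ) (p : ℝ) (hp0 : 0 < p) (K : ℝ≥0∞)
    (hK : ∀ f : (Fin d → ℝ) → ℝ, ContDiff ℝ 1 f →
      ∀ a ∈ closedBall (0 : Fin d → ℝ) 1, ∀ b ∈ closedBall (0 : Fin d → ℝ) 1, 
      ‖f a - f b‖ₑ ≤
        K * (∫⁻ r in closedBall (0 : Fin d → ℝ) 1, ‖fderiv ℝ f r‖ₑ ^ p) ^ (1/p))
    (u : EuclideanSpace ℝ (Fin (d+1)) → ℝ) (hu : ContDiff ℝ 1 u) (c) (t : ℝ) (i : Fin (d+1))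
    (σ : ℝ) (a) (ha : a ∈ closedBall (0 : Fin d → ℝ) 1) (b) (hb : b ∈ closedBall (0 : Fin d → ℝ) 1) :
    ‖u (c + facePt d i σ t a) - u (c + facePt d i σ t b)‖ₑ ≤
      K * (‖t‖ₑ * ‖faceL d i‖ₑ) * (∫⁻ r in closedBall (0 : Fin d → ℝ) 1,
        ‖fderiv ℝ u (c + facePt d i σ t r)‖ₑ ^ p) ^ (1/p) := by
  have hder : ∀ r, HasFDerivAt (fun r => c + facePt d i σ t r) (t • faceL d i) r := by
    intro r
    exact ((((faceL d i).hasFDerivAt (x := r)).const_add _).const_smul t).const_add c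
  have hcd : ContDiff ℝ 1 (fun r => c + facePt d i σ t r) := by
    unfold facePt
    exact contDiff_const.add (ContDiff.const_smul t (contDiff_const.add (faceL d i).contDiff))
  have hcont := hcd.continuous
  have hDu : Continuous (fderiv ℝ u) := hu.continuous_fderiv (by norm_num)
  refine (hK (fun r => u (c + facePt d i σ t r)) (hu.comp hcd) a ha b hb).trans ?_
  rw [mul_assoc]
  gcongr
  have h1 : ∀ r, ‖fderiv ℝ (fun r => u (c + facePt d i σ t r)) r‖ₑ ≤
      (‖t‖ₑ * ‖faceL d i‖ₑ) * ‖fderiv ℝ u (c + facePt d i σ t r)‖ₑ := by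
    intro r
    have := (((hu.differentiable (by norm_num)) (c + facePt d i σ t r)).hasFDerivAt.comp r (hder r)).fderiv
    have h2 : fderiv ℝ (fun r => u (c + facePt d i σ t r)) r = 
      (fderiv ℝ u (c + facePt d i σ t r)).comp (t • faceL d i) := this
    rw [h2, mul_comm, ← enorm_smul]
    exact ContinuousLinearMap.opENorm_comp_le _ _
  calc (∫⁻ r in closedBall (0 : Fin d → ℝ) 1, 
        ‖fderiv ℝ (fun r => u (c + facePt d i σ t r)) r‖ₑ ^ p) ^ (1/p)
      ≤ (∫⁻ r in closedBall (0 : Fin d → ℝ) 1, 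
        (‖t‖ₑ * ‖faceL d i‖ₑ) ^ p * ‖fderiv ℝ u (c + facePt d i σ t r)‖ₑ ^ p) ^ (1/p) := by
        gcongr with r
        rw [← ENNReal.mul_rpow_of_nonneg _ _ hp0.le]
        gcongr
        exact h1 r
    _ = _ := by
        have hmm : Measurable (fun r => ‖fderiv ℝ u (c + facePt d i σ t r)‖ₑ ^ p) :=
          (hDu.comp hcont).enorm.measurable.pow_const p
        rw [lintegral_const_mul _ hmm,
          ENNReal.mul_rpow_of_nonneg _ _ (by positivity), ← ENNReal.rpow_mul, 
          mul_one_div_cancel hp0.ne', ENNReal.rpow_one]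

/-- sum of face energies -/
noncomputable def faceEn (d : ℕ) (p : ℝ) (u : EuclideanSpace ℝ (Fin (d+1)) → ℝ) (t : ℝ)
    (c : EuclideanSpace ℝ (Fin (d+1))) : ℝ≥0∞ :=
  ∑ i, ((∫⁻ r in closedBall (0 : Fin d → ℝ) 1, ‖fderiv ℝ u (c + facePt d i 1 t r)‖ₑ ^ p) + 
    ∫⁻ r in closedBall (0 : Fin d → ℝ) 1, ‖fderiv ℝ u (c + facePt d i (-1) t r)‖ₑ ^ p)

lemma corner_bound (d : ℕ) (hd : 1 ≤ d) (p : ℝ) (hp0 : 0 < p) (K : ℝ≥0∞)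
    (hK : ∀ f : (Fin d → ℝ) → ℝ, ContDiff ℝ 1 f →
      ∀ a ∈ closedBall (0 : Fin d → ℝ) 1, ∀ b ∈ closedBall (0 : Fin d → ℝ) 1, 
      ‖f a - f b‖ₑ ≤
        K * (∫⁻ r in closedBall (0 : Fin d → ℝ) 1, ‖fderiv ℝ f r‖ₑ ^ p) ^ (1/p))
    (u : EuclideanSpace ℝ (Fin (d+1)) → ℝ) (hu : ContDiff ℝ 1 u) (c z) (t : ℝ) (ht : 0 < t)
    (hz : ‖(z - c).ofLp‖ = t) (huz : u z = 0) :
    ‖u (c + t • onesVec (d+1))‖ₑ ≤ 2 * (K * (‖t‖ₑ * ∑ i, ‖faceL d i‖ₑ) * faceEn d p u t c ^ (1/p)) := by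
  set B := K * (‖t‖ₑ * ∑ i, ‖faceL d i‖ₑ) * faceEn d p u t c ^ (1/p) with hB
  have key : ∀ (i : Fin (d+1)) (σ : ℝ), (σ = 1 ∨ σ = -1) → ∀ x y : EuclideanSpace ℝ (Fin (d+1)),
      x i = σ * t → (∀ j, |x j| ≤ t) → y i = σ * t → (∀ j, |y j| ≤ t) →
      ‖u (c + x) - u (c + y)‖ₑ ≤ B := by
    intro i σ hσ x y hx1 hx2 hy1 hy2
    obtain ⟨a, ha, rfl⟩ := exists_face d i σ t ht x hx1 hx2
    obtain ⟨b, hb, rfl⟩ := exists_face d i σ t ht y hy1 hy2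
    refine (face_osc d p hp0 K hK u hu c t i σ a ha b hb).trans ?_
    rw [hB]
    gcongr
    · exact Finset.single_le_sum (f := fun i => ‖faceL d i‖ₑ) (fun _ _ => zero_le) (Finset.mem_univ i)
    · refine le_trans ?_ (Finset.single_le_sum (f := fun i => 
        ((∫⁻ r in closedBall (0 : Fin d → ℝ) 1, ‖fderiv ℝ u (c + facePt d i 1 t r)‖ₑ ^ p) + 
    ∫⁻ r in closedBall (0 : Fin d → ℝ) 1, ‖fderiv ℝ u (c + facePt d i (-1) t r)‖ₑ ^ p))
        (fun _ _ => zero_le) (Finset.mem_univ i))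
      rcases hσ with rfl | rfl
      · exact le_self_add
      · exact le_add_self
  have hones : ∀ j, (t • onesVec (d+1)) j = t := by intro j; simp [onesVec]
  have hzj : ∀ j, |(z - c) j| ≤ t := by
    intro j; rw [← hz]; exact norm_le_pi_norm (z - c).ofLp j
  obtain ⟨i, hi⟩ : ∃ i, |(z - c) i| = t := by
    by_contra h
    push Not at h
    have : ‖(z - c).ofLp‖ < t := (pi_norm_lt_iff ht).2 fun j => lt_of_le_of_ne (hzj j) (h j)
    linarith
  have hzc : c + (z - c) = z := by abel
  rcases abs_eq ht.le |>.1 hi with h | h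
  · have := key i 1 (Or.inl rfl) (t • onesVec (d+1)) (z - c) (by rw [hones, one_mul]) 
      (fun j => by rw [hones, abs_of_pos ht]) (by rw [h, one_mul]) hzj
    rw [hzc, huz, sub_zero] at this
    exact this.trans (by rw [two_mul]; exact le_self_add)
  · set y : EuclideanSpace ℝ (Fin (d+1)) := WithLp.toLp 2 (fun j => if j = i then -t else t) with hy
    have hyj : ∀ j, |y j| ≤ t := by
      intro j; simp only [hy]; split_ifs <;> simp [abs_of_pos ht]
    have : Nontrivial (Fin (d+1)) := Fin.nontrivial_iff_two_le.2 (by omega)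
    obtain ⟨j, hj⟩ := exists_ne i
    have h1 := key j 1 (Or.inl rfl) (t • onesVec (d+1)) y (by rw [hones, one_mul]) 
      (fun j => by rw [hones, abs_of_pos ht]) (by simp [hy, hj]) hyj
    have h2 := key i (-1) (Or.inr rfl) y (z - c) (by simp [hy]) hyj (by rw [h]; ring) hzj
    rw [hzc, huz, sub_zero] at h2
    calc ‖u (c + t • onesVec (d+1))‖ₑ = ‖(u (c + t • onesVec (d+1)) - u (c + y)) + u (c + y)‖ₑ := by
          rw [sub_add_cancel]
      _ ≤ B + B := (enorm_add_le _ _).trans (by gcongr)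
      _ = _ := by ring

lemma lintegral_faceEn (d : ℕ) (p : ℝ) (u : EuclideanSpace ℝ (Fin (d+1)) → ℝ) (hu : ContDiff ℝ 1 u)
    (t : ℝ) : ∫⁻ c, faceEn d p u t c = (2 * (d+1) * volume (closedBall (0 : Fin d → ℝ) 1)) *
      ∫⁻ x, ‖fderiv ℝ u x‖ₑ ^ p := by
  have hDu : Continuous (fderiv ℝ u) := hu.continuous_fderiv (by norm_num)
  have hm : ∀ (i : Fin (d+1)) (σ : ℝ), Measurable 
      (fun z : EuclideanSpace ℝ (Fin (d+1)) × (Fin d → ℝ) => 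
      ‖fderiv ℝ u (z.1 + facePt d i σ t z.2)‖ₑ ^ p) := by
    intro i σ
    refine ((hDu.comp ?_).enorm.measurable).pow_const p
    unfold facePt
    fun_prop
  have hm2 : ∀ (i : Fin (d+1)) (σ : ℝ), Measurable (fun c : EuclideanSpace ℝ (Fin (d+1)) => 
      ∫⁻ r in closedBall (0 : Fin d → ℝ) 1, ‖fderiv ℝ u (c + facePt d i σ t r)‖ₑ ^ p) :=
    fun i σ => (hm i σ).lintegral_prod_right'
  have h1 : ∀ (i : Fin (d+1)) (σ : ℝ), ∫⁻ c : EuclideanSpace ℝ (Fin (d+1)), 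
      ∫⁻ r in closedBall (0 : Fin d → ℝ) 1, ‖fderiv ℝ u (c + facePt d i σ t r)‖ₑ ^ p = 
      volume (closedBall (0 : Fin d → ℝ) 1) * ∫⁻ x, ‖fderiv ℝ u x‖ₑ ^ p := by
    intro i σ
    rw [lintegral_lintegral_swap (hm i σ).aemeasurable]
    have : ∀ r, ∫⁻ c, ‖fderiv ℝ u (c + facePt d i σ t r)‖ₑ ^ p = ∫⁻ x, ‖fderiv ℝ u x‖ₑ ^ p :=
      fun r => lintegral_add_right_eq_self (fun x => ‖fderiv ℝ u x‖ₑ ^ p) _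
    simp only [this, lintegral_const, Measure.restrict_apply_univ]
    rw [mul_comm]
  unfold faceEn
  have hm3 : ∀ i ∈ (Finset.univ : Finset (Fin (d+1))),
      Measurable (fun c : EuclideanSpace ℝ (Fin (d+1)) => 
      (∫⁻ r in closedBall (0 : Fin d → ℝ) 1, ‖fderiv ℝ u (c + facePt d i 1 t r)‖ₑ ^ p) +
      ∫⁻ r in closedBall (0 : Fin d → ℝ) 1, ‖fderiv ℝ u (c + facePt d i (-1) t r)‖ₑ ^ p) :=
    fun i _ => (hm2 i 1).add (hm2 i (-1))
  rw [lintegral_finsetSum _ hm3]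
  simp_rw [lintegral_add_left (hm2 _ 1), h1]
  simp
  ring

lemma lintegral_poincare (d : ℕ) (hd : 1 ≤ d) (p : ℝ) (hp : (d:ℝ) < p) :
    ∃ D : ℝ≥0∞, D ≠ ⊤ ∧ ∀ (u : EuclideanSpace ℝ (Fin (d+1)) → ℝ) (t : ℝ), ContDiff ℝ 1 u → 0 < t →
      (∀ c, ∃ z, ‖(z - c).ofLp‖ = t ∧ u z = 0) →
      ∫⁻ x, ‖u x‖ₑ ^ p ≤ D * ENNReal.ofReal (t ^ p) * ∫⁻ x, ‖fderiv ℝ u x‖ₑ ^ p := by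
  have hd' : (1:ℝ) ≤ d := by exact_mod_cast hd
  have hp0 : 0 < p := by linarith
  obtain ⟨K, hKt, hK⟩ := morrey d p hp (by linarith)
  refine ⟨(2 * K * ∑ i, ‖faceL d i‖ₑ) ^ p * (2 * (d+1) * volume (closedBall (0 : Fin d → ℝ) 1)), ?_, ?_⟩
  · have hQt : volume (closedBall (0 : Fin d → ℝ) 1) ≠ ⊤ := (isCompact_closedBall _ _).measure_lt_top.ne
    have hS : ∑ i, ‖faceL d i‖ₑ ≠ ⊤ := ENNReal.sum_ne_top.2 fun i _ => enorm_ne_top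
    refine ENNReal.mul_ne_top (ENNReal.rpow_ne_top_of_nonneg hp0.le ?_) (ENNReal.mul_ne_top ?_ hQt)
    · exact ENNReal.mul_ne_top (ENNReal.mul_ne_top (by simp) hKt) hS
    · exact ENNReal.mul_ne_top (by simp) (by finiteness)
  intro u t hu ht hz
  rw [← lintegral_add_right_eq_self (fun x => ‖u x‖ₑ ^ p) (t • onesVec (d+1))]
  calc ∫⁻ c, ‖u (c + t • onesVec (d+1))‖ₑ ^ p 
      ≤ ∫⁻ c, ((2 * K * ∑ i, ‖faceL d i‖ₑ) ^ p * ENNReal.ofReal (t ^ p)) * faceEn d p u t c := by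
        refine lintegral_mono fun c => ?_
        obtain ⟨z, hz1, hz2⟩ := hz c
        have := corner_bound d hd p hp0 K hK u hu c z t ht hz1 hz2
        calc _ ≤ _ := ENNReal.rpow_le_rpow this hp0.le
          _ = ((2 * K * ∑ i, ‖faceL d i‖ₑ) * ‖t‖ₑ * faceEn d p u t c ^ (1/p)) ^ p := by
              congr 1; ring
          _ = _ := by
              rw [ENNReal.mul_rpow_of_nonneg _ _ hp0.le, ENNReal.mul_rpow_of_nonneg _ _ hp0.le,
                ← ENNReal.rpow_mul, one_div_mul_cancel hp0.ne', ENNReal.rpow_one,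
                ← ENNReal.ofReal_rpow_of_pos ht, Real.enorm_of_nonneg ht.le]
    _ = ((2 * K * ∑ i, ‖faceL d i‖ₑ) ^ p * ENNReal.ofReal (t ^ p)) * ∫⁻ c, faceEn d p u t c := by
        apply lintegral_const_mul'
        refine ENNReal.mul_ne_top (ENNReal.rpow_ne_top_of_nonneg hp0.le ?_) ENNReal.ofReal_ne_top
        exact ENNReal.mul_ne_top (ENNReal.mul_ne_top (by simp) hKt) 
          (ENNReal.sum_ne_top.2 fun i _ => enorm_ne_top)
    _ = _ := by rw [lintegral_faceEn d p u hu t]; ring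

lemma real_poincare (d : ℕ) (hd : 1 ≤ d) (p : ℝ) (hp : (d:ℝ) < p) :
    ∃ D : ℝ, 0 < D ∧ ∀ (u : EuclideanSpace ℝ (Fin (d+1)) → ℝ) (t : ℝ), ContDiff ℝ 1 u → 
      HasCompactSupport u → 0 < t →
      (∀ c, ∃ z, ‖(z - c).ofLp‖ = t ∧ u z = 0) →
      ∫ x, |u x| ^ p ≤ D * t ^ p * ∫ x, ‖fderiv ℝ u x‖ ^ p := by
  have hd' : (1:ℝ) ≤ d := by exact_mod_cast hd
  have hp0 : 0 < p := by linarith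
  obtain ⟨D, hD, h⟩ := lintegral_poincare d hd p hp
  refine ⟨D.toReal + 1, by positivity, ?_⟩
  intro u t hu hcs ht hz
  have hDu : Continuous (fderiv ℝ u) := hu.continuous_fderiv (by norm_num)
  have key := h u t hu ht hz
  have i2 : Integrable (fun x => ‖fderiv ℝ u x‖ ^ p) := by
    refine Continuous.integrable_of_hasCompactSupport
      (hDu.norm.rpow_const fun _ => Or.inr hp0.le) ?_
    exact (hcs.fderiv ℝ).comp_left (g := fun L => ‖L‖ ^ p) (by simp [hp0.ne'])
  have e1 : ∫ x, |u x| ^ p = (∫⁻ x, ‖u x‖ₑ ^ p).toReal := by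
    rw [integral_eq_lintegral_of_nonneg_ae (Filter.Eventually.of_forall fun x => by positivity)
      (hu.continuous.abs.rpow_const fun _ => Or.inr hp0.le).aestronglyMeasurable]
    congr 2
    ext x
    rw [← ENNReal.ofReal_rpow_of_nonneg (abs_nonneg _) hp0.le, Real.enorm_eq_ofReal_abs]
  have e2' : ∀ x, ENNReal.ofReal (‖fderiv ℝ u x‖ ^ p) = ‖fderiv ℝ u x‖ₑ ^ p := by
    intro x
    rw [← ENNReal.ofReal_rpow_of_nonneg (norm_nonneg _) hp0.le, ofReal_norm]
  have e2 : ∫ x, ‖fderiv ℝ u x‖ ^ p = (∫⁻ x, ‖fderiv ℝ u x‖ₑ ^ p).toReal := by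
    rw [integral_eq_lintegral_of_nonneg_ae (Filter.Eventually.of_forall fun x => by positivity)
      i2.aestronglyMeasurable]
    simp_rw [e2']
  have f2 : ∫⁻ x, ‖fderiv ℝ u x‖ₑ ^ p ≠ ⊤ := by
    simp_rw [← e2']
    exact i2.lintegral_lt_top.ne
  rw [e1, e2]
  calc _ ≤ (D * ENNReal.ofReal (t ^ p) * ∫⁻ x, ‖fderiv ℝ u x‖ₑ ^ p).toReal :=
        ENNReal.toReal_mono (by finiteness) key
    _ = D.toReal * t ^ p * (∫⁻ x, ‖fderiv ℝ u x‖ₑ ^ p).toReal := by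
        rw [ENNReal.toReal_mul, ENNReal.toReal_mul, ENNReal.toReal_ofReal (by positivity)]
    _ ≤ _ := by gcongr; linarith

lemma inradius_facts (d : ℕ) (Om : Set (EuclideanSpace ℝ (Fin (d+1)))) (hO : IsOpen Om)
    (hne : Om.Nonempty) (hB : Bornology.IsBounded Om) :
    0 < inradius (d+1) Om ∧ ∀ c, ∃ e, e ∉ Om ∧ dist e c < 2 * inradius (d+1) Om := by
  have hbdd : BddAbove { r | ∃ c : EuclideanSpace ℝ (Fin (d+1)), Metric.ball c r ⊆ Om } := by
    refine ⟨Metric.diam Om, ?_⟩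
    rintro r ⟨c, hc⟩
    rcases le_or_gt r 0 with h | h
    · exact h.trans Metric.diam_nonneg
    · have h1 := Metric.diam_mono hc hB
      rw [Metric.diam_ball_eq c h.le] at h1
      linarith
  have hpos : 0 < inradius (d+1) Om := by
    obtain ⟨x, hx⟩ := hne
    obtain ⟨r, hr, hxr⟩ := Metric.isOpen_iff.1 hO x hx
    exact hr.trans_le (le_csSup hbdd ⟨x, hxr⟩)
  refine ⟨hpos, fun c => ?_⟩
  by_contra hcon
  push Not at hcon
  have : 2 * inradius (d+1) Om ≤ inradius (d+1) Om := by
    refine le_csSup hbdd ⟨c, fun e he => ?_⟩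
    by_contra h
    exact absurd (mem_ball.1 he) (not_lt.2 (hcon e h))
  linarith

lemma exists_test (N : ℕ) (Om : Set (EuclideanSpace ℝ (Fin N))) (hO : IsOpen Om)
    (hne : Om.Nonempty) : ∃ u : EuclideanSpace ℝ (Fin N) → ℝ, ContDiff ℝ (⊤ : ℕ∞) u ∧
      HasCompactSupport u ∧ tsupport u ⊆ Om ∧ u ≠ 0 := by
  obtain ⟨x, hx⟩ := hne
  obtain ⟨f, h1, h2, h3, -, h5⟩ := exists_contDiff_tsupport_subset (n := ⊤) (hO.mem_nhds hx)
  refine ⟨f, h3, h2, h1, fun h => ?_⟩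
  rw [h] at h5; simp at h5

lemma no_one_dim (Om : Set (EuclideanSpace ℝ (Fin 1))) (hO : IsOpen Om)
    (hB : Bornology.IsBounded Om) (hne : Om.Nonempty) (hF : IsConnected (frontier Om)) : False := by
  -- two frontier points on both sides of a point of the set
  obtain ⟨x, hx⟩ := hne
  obtain ⟨R, hR⟩ := Bornology.IsBounded.subset_closedBall hB x
  have hR0 : 0 ≤ R := by simpa using hR hx
  have hout : ∀ k : ℝ, R < |k| → x + EuclideanSpace.single 0 k ∉ Om := by
    intro k hk h
    have h1 := hR h
    rw [mem_closedBall, dist_eq_norm, add_sub_cancel_left] at h1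
    simp at h1
    linarith
  have hcont : Continuous (fun y : EuclideanSpace ℝ (Fin 1) => y 0) := by fun_prop
  have hpc : ∀ k : ℝ, IsPreconnected (segment ℝ x (x + EuclideanSpace.single 0 k)) :=
    fun k => (convex_segment _ _).isPreconnected
  obtain ⟨y1, hy1, hy1F⟩ := hit_frontier (hpc (R+1)) hO (left_mem_segment ℝ _ _) hx
    (right_mem_segment ℝ _ _) (hout _ (by rw [abs_of_pos] <;> linarith))
  obtain ⟨y2, hy2, hy2F⟩ := hit_frontier (hpc (-(R+1))) hO (left_mem_segment ℝ _ _) hx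
    (right_mem_segment ℝ _ _) (hout _ (by rw [abs_neg, abs_of_pos] <;> linarith))
  have g1 : x 0 ≤ y1 0 := by
    obtain ⟨α, β, hα, hβ, hab, rfl⟩ := hy1
    have : α = 1 - β := by linarith
    subst this
    simp
    nlinarith
  have g2 : y2 0 ≤ x 0 := by
    obtain ⟨α, β, hα, hβ, hab, rfl⟩ := hy2
    have : α = 1 - β := by linarith
    subst this
    simp
    nlinarith
  obtain ⟨z, hzF, hz⟩ := hF.isPreconnected.intermediate_value hy2F hy1F hcont.continuousOn
    (show x 0 ∈ Icc _ _ from ⟨g2, g1⟩)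
  have : z = x := by
    ext i; rw [Subsingleton.elim i 0]; exact hz
  rw [hO.frontier_eq, this] at hzF
  exact hzF.2 hx

theorem main_connected_boundary (N : ℕ) (p : ℝ) (hp : (N : ℝ) - 1 < p) :
    ∃ C : ℝ, 0 < C ∧ ∀ (Ω : Set (EuclideanSpace ℝ (Fin N))),
      IsOpen Ω → IsConnected Ω → Bornology.IsBounded Ω →
      IsConnected (frontier Ω) →
      C * inradius N Ω ^ (-p) ≤ pEigen N p Ω := by
  rcases N with _ | d
  · refine ⟨1, one_pos, fun Ω hO hC hB hF => ?_⟩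
    exfalso
    obtain ⟨x, hx⟩ := hF.nonempty
    obtain ⟨y, hy⟩ := hC.nonempty
    rw [hO.frontier_eq, Subsingleton.elim x y] at hx
    exact hx.2 hy
  rcases Nat.eq_zero_or_pos d with rfl | hd
  · exact ⟨1, one_pos, fun Ω hO hC hB hF => (no_one_dim Ω hO hB hC.nonempty hF).elim⟩
  have hd' : (1:ℝ) ≤ d := by exact_mod_cast hd
  have hdp : (d:ℝ) < p := by push_cast at hp; linarith
  have hp0 : 0 < p := by linarith
  obtain ⟨D, hD, hpoin⟩ := real_poincare d hd p hdp
  refine ⟨1 / (D * 2 ^ p), by positivity, fun Ω hO hC hB hF => ?_⟩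
  obtain ⟨hρ, hin⟩ := inradius_facts d Ω hO hC.nonempty hB
  set ρ := inradius (d+1) Ω
  unfold pEigen
  apply le_csInf
  · obtain ⟨u, h1, h2, h3, h4⟩ := exists_test (d+1) Ω hO hC.nonempty
    exact ⟨_, u, h1, h2, h3, h4, rfl⟩
  rintro _ ⟨u, hu, hcs, hsupp, hu0, rfl⟩
  have hu1 : ContDiff ℝ 1 u := hu.of_le (by exact_mod_cast le_top)
  have hzero : ∀ x ∉ Ω, u x = 0 := fun x hx => image_eq_zero_of_notMem_tsupport fun h => hx (hsupp h)
  have hzero' : ∀ x ∉ Ω, fderiv ℝ u x = 0 := fun x hx => 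
    image_eq_zero_of_notMem_tsupport fun h => hx (hsupp (tsupport_fderiv_subset ℝ h))
  rw [setIntegral_eq_integral_of_forall_compl_eq_zero (fun x hx => by simp [hzero' x hx, hp0.ne']),
    setIntegral_eq_integral_of_forall_compl_eq_zero (fun x hx => by simp [hzero x hx, hp0.ne'])]
  have hmain := hpoin u (2 * ρ) hu1 hcs (by positivity) (by
    intro c
    obtain ⟨e, he, hec⟩ := hin c
    obtain ⟨z, hz1, hz2⟩ := meets_sphere d Ω hO hB hF c e (2 * ρ) (by positivity) he (by
      refine le_trans ?_ hec.le
      rw [dist_eq_norm, pi_norm_le_iff_of_nonneg (norm_nonneg _)]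
      exact fun i => PiLp.norm_apply_le (e - c) i)
    exact ⟨z, hz2, hzero z hz1⟩)
  have hcu : Continuous (fun x => |u x| ^ p) :=
    hu.continuous.abs.rpow_const fun _ => Or.inr hp0.le
  have hpos : 0 < ∫ x, |u x| ^ p := by
    have hi : Integrable (fun x => |u x| ^ p) := hcu.integrable_of_hasCompactSupport
      (hcs.comp_left (g := fun y => |y| ^ p) (by simp [hp0.ne']))
    obtain ⟨x, hx⟩ := Function.ne_iff.1 hu0
    refine hcu.integral_pos_of_hasCompactSupport_nonneg_nonzero
      (hcs.comp_left (g := fun y => |y| ^ p) (by simp [hp0.ne'])) (fun x => by positivity)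
      (x := x) ?_
    have : 0 < |u x| := abs_pos.2 hx
    positivity
  rw [le_div_iff₀ hpos, Real.rpow_neg hρ.le]
  rw [Real.mul_rpow (by norm_num) hρ.le] at hmain
  have h2p : (0:ℝ) < 2 ^ p := by positivity
  have hrp : 0 < ρ ^ p := by positivity
  calc 1 / (D * 2 ^ p) * (ρ ^ p)⁻¹ * ∫ x, |u x| ^ p 
      ≤ 1 / (D * 2 ^ p) * (ρ ^ p)⁻¹ * (D * (2 ^ p * ρ ^ p) * ∫ x, ‖fderiv ℝ u x‖ ^ p) := by
        gcongr
    _ = _ := by field_simp
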